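/- Let (R, m) be an F-finite regular local ring of prime characteristic p > 0 and let I ⊊ R be an unmixed reduced ideal of height h > 0. Then for every power q = p^e one has I^{h(q−1)} ⊆ (I^{[q]} : I). -/

import Mathlib

/-!  Common definitions: F-singularities of pairs `(R, a₁^{t₁} ⋯ a_k^{t_k})`
(Takagi, "F-singularities of pairs and Inversion of Adjunction of arbitrary
codimension"). -/

/-- The subring of `p`-th powers of `R`. -/
def pthPowers (R : Type*) [CommRing R] (p : ℕ) : Subring R :=
  Subring.closure (Set.range fun x : R => x ^ p)

/-- `R` is F-finite: it is a finitely generated module over its subring of `p`-th powers. -/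
def FFinite (R : Type*) [CommRing R] (p : ℕ) : Prop :=
  Module.Finite (pthPowers R p) R

/-- `c^{1/q} R → R^{1/q}` splits as an `R`-module homomorphism: there is an additive
map `φ : R → R` with `φ (a ^ q * x) = a * φ x` for all `a x` and `φ c = 1`. -/
def SplitsAlong (R : Type*) [CommRing R] (c : R) (q : ℕ) : Prop :=
  ∃ φ : R →+ R, (∀ a x : R, φ (a ^ q * x) = a * φ x) ∧ φ c = 1

/-- Membership in `R°`: `c` lies in no minimal prime of `R`. -/
def NotInMinimalPrimes (R : Type*) [CommRing R] (c : R) : Prop :=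
  ∀ P ∈ minimalPrimes R, c ∉ P

/-- F-purity of the pair `(R, a₁^{t₁} ⋯ a_k^{t_k})`: for all sufficiently large
`q = p^e` there is `d ∈ a₁^{⌊t₁(q-1)⌋} ⋯ a_k^{⌊t_k(q-1)⌋}` such that
`d^{1/q} R → R^{1/q}` splits. -/
def FPurePair (R : Type*) [CommRing R] (p : ℕ) {k : ℕ}
    (a : Fin k → Ideal R) (t : Fin k → ℝ) : Prop :=
  ∃ e₀ : ℕ, ∀ e : ℕ, e₀ ≤ e →
    ∃ d ∈ ∏ i, a i ^ ⌊t i * ((p ^ e : ℝ) - 1)⌋₊, SplitsAlong R d (p ^ e)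

/-- Strong F-regularity of the pair `(R, a₁^{t₁} ⋯ a_k^{t_k})`: for every `c ∈ R°`
there are `q = p^e` and `d ∈ a₁^{⌊t₁(q-1)⌋} ⋯ a_k^{⌊t_k(q-1)⌋}` such that
`(cd)^{1/q} R → R^{1/q}` splits. -/
def StronglyFRegularPair (R : Type*) [CommRing R] (p : ℕ) {k : ℕ}
    (a : Fin k → Ideal R) (t : Fin k → ℝ) : Prop :=
  ∀ c : R, NotInMinimalPrimes R c →
    ∃ e : ℕ, ∃ d ∈ ∏ i, a i ^ ⌊t i * ((p ^ e : ℝ) - 1)⌋₊, SplitsAlong R (c * d) (p ^ e)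

/-- Pure F-regularity of the pair `(R, a₁^{t₁} ⋯ a_k^{t_k})`: for every `c ∈ R°` not
in any minimal prime of `a₁ ⋯ a_k`, for all sufficiently large `q = p^e` there is
`d ∈ a₁^{⌊t₁(q-1)⌋} ⋯ a_k^{⌊t_k(q-1)⌋}` such that `(cd)^{1/q} R → R^{1/q}` splits. -/
def PurelyFRegularPair (R : Type*) [CommRing R] (p : ℕ) {k : ℕ}
    (a : Fin k → Ideal R) (t : Fin k → ℝ) : Prop :=
  ∀ c : R, NotInMinimalPrimes R c → (∀ P ∈ (∏ i, a i).minimalPrimes, c ∉ P) →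
    ∃ e₀ : ℕ, ∀ e : ℕ, e₀ ≤ e →
      ∃ d ∈ ∏ i, a i ^ ⌊t i * ((p ^ e : ℝ) - 1)⌋₊, SplitsAlong R (c * d) (p ^ e)

/-- A strongly F-regular ring: for every `c ∈ R°` there is `q = p^e` such that
`c^{1/q} R → R^{1/q}` splits. -/
def StronglyFRegularRing (R : Type*) [CommRing R] (p : ℕ) : Prop :=
  ∀ c : R, NotInMinimalPrimes R c → ∃ e : ℕ, SplitsAlong R c (p ^ e)

/-- The Frobenius power `J^{[q]}`, the ideal generated by `q`-th powers of elements
of `J`. -/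
def frobeniusPower {R : Type*} [CommRing R] (J : Ideal R) (q : ℕ) : Ideal R :=
  Ideal.span ((fun x => x ^ q) '' (J : Set R))

/-- A regular local ring: a Noetherian local ring whose maximal ideal is generated
by `dim R` elements. -/
def IsRegularLocal (R : Type*) [CommRing R] [IsLocalRing R] : Prop :=
  IsNoetherianRing R ∧
    ∃ s : Finset R, Ideal.span (s : Set R) = IsLocalRing.maximalIdeal R ∧
      (s.card : WithBot ℕ∞) = ringKrullDim R

/-- The height of a prime ideal. -/
noncomputable def primeHeight {R : Type*} [CommRing R] (P : Ideal R) (hP : P.IsPrime) : ℕ∞ :=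
  Order.height (⟨P, hP⟩ : PrimeSpectrum R)

/-- `I` is an unmixed reduced ideal of height `h`: `I` is radical and every minimal
prime of `I` has height `h`. -/
def UnmixedReducedOfHeight {R : Type*} [CommRing R] (I : Ideal R) (h : ℕ) : Prop :=
  I.IsRadical ∧ ∀ (P : Ideal R) (hP : P.IsPrime), P ∈ I.minimalPrimes →
    primeHeight P hP = (h : ℕ∞)

section Length

variable {R : Type*} [CommRing R]

theorem Module.length_le_add_of_exact {M N P : Type*} [AddCommGroup M] [AddCommGroup N]
    [AddCommGroup P] [Module R M] [Module R N] [Module R P] (f : N →ₗ[R] M) (g : M →ₗ[R] P)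
    (hg : Function.Surjective g) (H : Function.Exact f g) :
    Module.length R M ≤ Module.length R N + Module.length R P := by
  rw [Module.length_eq_add_of_exact (LinearMap.range f).subtype g
    (Submodule.subtype_injective _) hg fun x => (H x).trans (by simp)]
  gcongr
  exact Module.length_le_of_surjective f.rangeRestrict f.surjective_rangeRestrict

namespace Ideal

variable (y w : R) (K : Ideal R)

/-- Multiplication by `y` as a map `R ⧸ ((w) + K) → R ⧸ ((y * w) + K)`. -/
def quotientMulMap : (R ⧸ (span {w} ⊔ K)) →ₗ[R] R ⧸ (span {y * w} ⊔ K) :=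
  Submodule.mapQ _ _ (LinearMap.mulLeft R y) <| by
    rw [← Submodule.map_le_iff_le_comap, Submodule.map_sup]
    refine sup_le_sup ?_ ?_
    · rw [Ideal.span, Submodule.map_span, Set.image_singleton, LinearMap.mulLeft_apply]
    · rintro _ ⟨k, hk, rfl⟩
      exact K.mul_mem_left y hk

theorem span_mul_sup_le : span {y * w} ⊔ K ≤ span {y} ⊔ K :=
  sup_le_sup_right ((span_singleton_le_span_singleton).2 (dvd_mul_right y w)) K

theorem exact_quotientMulMap_factor :
    Function.Exact (quotientMulMap y w K) (Submodule.factor (span_mul_sup_le y w K)) := by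
  intro a
  obtain ⟨a, rfl⟩ := Submodule.Quotient.mk_surjective _ a
  constructor
  · intro h
    replace h : a ∈ span {y} ⊔ K := (Submodule.Quotient.mk_eq_zero _).1 h
    obtain ⟨b, hb, k, hk, rfl⟩ := Submodule.mem_sup.1 h
    obtain ⟨c, rfl⟩ := mem_span_singleton.1 hb
    refine ⟨Submodule.Quotient.mk c, ?_⟩
    refine (Submodule.Quotient.eq _).2 ?_
    refine mem_sup_right ?_
    simpa using hk
  · rintro ⟨c, hc⟩
    obtain ⟨c, rfl⟩ := Submodule.Quotient.mk_surjective _ c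
    rw [← hc]
    exact (Submodule.Quotient.mk_eq_zero _).2
      (mem_sup_left (mem_span_singleton.2 (dvd_mul_right y c)))

theorem length_quotient_span_mul_sup_le :
    Module.length R (R ⧸ (span {y * w} ⊔ K)) ≤
      Module.length R (R ⧸ (span {w} ⊔ K)) + Module.length R (R ⧸ (span {y} ⊔ K)) :=
  Module.length_le_add_of_exact _ _ (Submodule.factor_surjective _)
    (exact_quotientMulMap_factor y w K)

variable {y w K}

theorem length_quotient_span_mul_sup_eq
    (h : ∀ c, y * c ∈ span {y * w} ⊔ K → c ∈ span {w} ⊔ K) :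
    Module.length R (R ⧸ (span {y * w} ⊔ K)) =
      Module.length R (R ⧸ (span {w} ⊔ K)) + Module.length R (R ⧸ (span {y} ⊔ K)) := by
  refine Module.length_eq_add_of_exact _ _ ?_ (Submodule.factor_surjective _)
    (exact_quotientMulMap_factor y w K)
  refine (injective_iff_map_eq_zero _).2 fun c hc => ?_
  obtain ⟨c, rfl⟩ := Submodule.Quotient.mk_surjective _ c
  exact (Submodule.Quotient.mk_eq_zero _).2 (h c ((Submodule.Quotient.mk_eq_zero _).1 hc))

end Ideal

end Length

section Lech

open Function

variable {R ι : Type*} [CommRing R] [DecidableEq ι]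

/-- A family `u` is Lech independent if every relation between its members has all its
coefficients in the ideal generated by `u`. -/
def LechIndependent {R ι : Type*} [CommRing R] [Fintype ι] (u : ι → R) : Prop :=
  ∀ c : ι → R, ∑ i, c i * u i = 0 → ∀ i, c i ∈ Ideal.span (Set.range u)

theorem span_range_update (u : ι → R) (j : ι) (y : R) :
    Ideal.span (Set.range (update u j y)) = Ideal.span {y} ⊔ Ideal.span (u '' {j}ᶜ) := by
  rw [← Ideal.span_union]
  congr 1
  ext x
  simp only [Set.mem_range, Set.singleton_union, Set.mem_insert_iff, Set.mem_image,
    Set.mem_compl_iff, Set.mem_singleton_iff]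
  constructor
  · rintro ⟨i, rfl⟩
    by_cases hi : i = j
    · subst hi; simp
    · exact Or.inr ⟨i, hi, by simp [hi]⟩
  · rintro (rfl | ⟨i, hi, rfl⟩)
    · exact ⟨j, by simp⟩
    · exact ⟨i, by simp [hi]⟩

theorem span_range_le_update_of_dvd {u : ι → R} {j : ι} {y : R} (h : y ∣ u j) :
    Ideal.span (Set.range u) ≤ Ideal.span (Set.range (update u j y)) := by
  conv_lhs => rw [← update_eq_self j u]
  rw [span_range_update, span_range_update]
  exact sup_le_sup_right (Ideal.span_singleton_le_span_singleton.2 h) _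

theorem length_quotient_update_mul_le (u : ι → R) (j : ι) (y w : R) :
    Module.length R (R ⧸ Ideal.span (Set.range (update u j (y * w)))) ≤
      Module.length R (R ⧸ Ideal.span (Set.range (update u j w))) +
        Module.length R (R ⧸ Ideal.span (Set.range (update u j y))) := by
  rw [span_range_update, span_range_update, span_range_update]
  exact Ideal.length_quotient_span_mul_sup_le y w _

theorem length_quotient_update_pow_le (u : ι → R) (j : ι) (q : ℕ) :
    Module.length R (R ⧸ Ideal.span (Set.range (update u j (u j ^ q)))) ≤
      q * Module.length R (R ⧸ Ideal.span (Set.range u)) := by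
  induction q with
  | zero =>
    have : Ideal.span (Set.range (update u j (u j ^ 0))) = ⊤ := by
      simp [span_range_update]
    rw [this]
    simp [Module.length_eq_zero]
  | succ q ih =>
    rw [pow_succ']
    refine (length_quotient_update_mul_le u j _ _).trans ?_
    rw [update_eq_self]
    push_cast
    rw [add_mul, one_mul]
    gcongr

theorem length_quotient_span_pow_le (u : ι → R) (q : ℕ) (s : Finset ι) :
    Module.length R (R ⧸ Ideal.span (Set.range fun i => if i ∈ s then u i ^ q else u i)) ≤
      q ^ s.card * Module.length R (R ⧸ Ideal.span (Set.range u)) := by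
  induction s using Finset.induction_on with
  | empty => simpa using! le_rfl
  | insert j s hj ih =>
    have h : (fun i => if i ∈ insert j s then u i ^ q else u i) =
        update (fun i => if i ∈ s then u i ^ q else u i) j
          ((fun i => if i ∈ s then u i ^ q else u i) j ^ q) := by
      ext i
      by_cases hi : i = j
      · subst hi; simp [hj]
      · simp [hi]
    rw [h, Finset.card_insert_of_notMem hj, pow_succ', mul_assoc]
    refine (length_quotient_update_pow_le _ _ _).trans ?_
    gcongr

variable [Fintype ι]

theorem sum_update_mul (u c : ι → R) (j : ι) (y z : R) :
    ∑ i, update c j z i * update u j y i = z * y + ∑ i ∈ Finset.univ.erase j, c i * u i := by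
  rw [← Finset.add_sum_erase _ _ (Finset.mem_univ j)]
  simp only [update_self]
  congr 1
  refine Finset.sum_congr rfl fun i hi => ?_
  simp [Finset.ne_of_mem_erase hi]

theorem sum_update_mul_left (u c : ι → R) (j : ι) (z : R) :
    ∑ i, update c j z i * u i = z * u j + ∑ i ∈ Finset.univ.erase j, c i * u i := by
  simpa using sum_update_mul u c j (u j) z

namespace LechIndependent

variable {u : ι → R} {j : ι} {y w : R}

theorem update_of_eq_mul (hu : LechIndependent u) (hyw : u j = y * w) :
    LechIndependent (update u j y) := by
  intro c hc
  have hle : Ideal.span (Set.range u) ≤ Ideal.span (Set.range (update u j y)) :=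
    span_range_le_update_of_dvd ⟨w, hyw⟩
  have hy : y ∈ Ideal.span (Set.range (update u j y)) :=
    Ideal.subset_span ⟨j, update_self j y u⟩
  rw [← update_eq_self j c, sum_update_mul] at hc
  have hcj : c j ∈ Ideal.span (Set.range u) := by
    have := hu (update (fun i => w * c i) j (c j)) (by
      rw [sum_update_mul_left, hyw]
      simp only [mul_assoc, ← Finset.mul_sum]
      linear_combination w * hc) j
    simpa using this
  obtain ⟨b, hb⟩ := (Ideal.mem_span_range_iff_exists_fun).1 hcj
  intro i
  by_cases hi : i = j
  · subst hi; exact hle hcj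
  have := hu (fun i => y * b i + update c j 0 i) (by
    simp only [add_mul, Finset.sum_add_distrib, mul_assoc, ← Finset.mul_sum]
    rw [sum_update_mul_left, hb]
    linear_combination hc) i
  simp only [ne_eq, hi, not_false_eq_true, update_of_ne] at this
  exact (Ideal.add_mem_iff_right _ (Ideal.mul_mem_right _ _ hy)).1 (hle this)

theorem mem_of_mul_mem (hu : LechIndependent u) (hyw : u j = y * w) {c : R}
    (hc : y * c ∈ Ideal.span (Set.range u)) :
    c ∈ Ideal.span (Set.range (update u j w)) := by
  obtain ⟨b, hb⟩ := (Ideal.mem_span_range_iff_exists_fun).1 hc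
  have hw : w ∈ Ideal.span (Set.range (update u j w)) :=
    Ideal.subset_span ⟨j, update_self j w u⟩
  have := hu (fun i => update (0 : ι → R) j c i - w * b i) (by
    simp only [sub_mul, Finset.sum_sub_distrib, mul_assoc, ← Finset.mul_sum, hb]
    rw [sum_update_mul_left, hyw]
    simp
    ring) j
  simp only [update_self] at this
  have h2 := span_range_le_update_of_dvd (u := u) (j := j) (y := w) ⟨y, by rw [hyw, mul_comm]⟩ this
  simpa using (Ideal.add_mem _ h2 (Ideal.mul_mem_right (b j) _ hw))

theorem length_quotient_eq (hu : LechIndependent u) (hyw : u j = y * w) :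
    Module.length R (R ⧸ Ideal.span (Set.range u)) =
      Module.length R (R ⧸ Ideal.span (Set.range (update u j w))) +
        Module.length R (R ⧸ Ideal.span (Set.range (update u j y))) := by
  have h := fun c => hu.mem_of_mul_mem hyw (c := c)
  rw [← update_eq_self j u, hyw, update_idem] at h
  conv_lhs => rw [← update_eq_self j u, hyw]
  rw [span_range_update, span_range_update] at h
  rw [span_range_update, span_range_update, span_range_update]
  exact Ideal.length_quotient_span_mul_sup_eq h

end LechIndependent

theorem LechIndependent.mul_length_le {u : ι → R} {j : ι} {y : R} {q : ℕ}
    (hu : LechIndependent (update u j (y ^ q))) (hq : q ≠ 0) :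
    LechIndependent (update u j y) ∧
    q * Module.length R (R ⧸ Ideal.span (Set.range (update u j y))) ≤
      Module.length R (R ⧸ Ideal.span (Set.range (update u j (y ^ q)))) := by
  induction q, Nat.one_le_iff_ne_zero.2 hq using Nat.le_induction with
  | base =>
    rw [pow_one] at hu ⊢
    exact ⟨hu, by simp⟩
  | succ q hq' ih =>
    have hy : update u j (y ^ (q + 1)) j = y ^ q * y := by simp [pow_succ]
    have h1 := hu.update_of_eq_mul hy
    rw [update_idem] at h1
    obtain ⟨h2, h3⟩ := ih h1 (by omega)
    refine ⟨h2, ?_⟩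
    rw [hu.length_quotient_eq hy, update_idem, update_idem]
    push_cast
    rw [add_mul, one_mul, add_comm]
    gcongr

theorem LechIndependent.pow_mul_length_le {u : ι → R} {q : ℕ} (hq : q ≠ 0) (s : Finset ι)
    (hu : LechIndependent fun i => if i ∈ s then u i ^ q else u i) :
    q ^ s.card * Module.length R (R ⧸ Ideal.span (Set.range u)) ≤
      Module.length R (R ⧸ Ideal.span (Set.range fun i => if i ∈ s then u i ^ q else u i)) := by
  induction s using Finset.induction_on with
  | empty => simpa using! le_rfl
  | insert j s hj ih =>
    have h : (fun i => if i ∈ insert j s then u i ^ q else u i) =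
        update (fun i => if i ∈ s then u i ^ q else u i) j (u j ^ q) := by
      ext i
      by_cases hi : i = j
      · subst hi; simp
      · simp [hi]
    have h' : update (fun i => if i ∈ s then u i ^ q else u i) j (u j) =
        fun i => if i ∈ s then u i ^ q else u i := by
      refine update_eq_iff.2 ⟨by simp [hj], fun _ _ => rfl⟩
    rw [h] at hu ⊢
    obtain ⟨h1, h2⟩ := hu.mul_length_le hq
    rw [h'] at h1 h2
    rw [Finset.card_insert_of_notMem hj, pow_succ', mul_assoc]
    refine le_trans ?_ h2
    gcongr
    exact ih h1

theorem length_quotient_span_pow_le_univ (u : ι → R) (q : ℕ) :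
    Module.length R (R ⧸ Ideal.span (Set.range fun i => u i ^ q)) ≤
      q ^ Fintype.card ι * Module.length R (R ⧸ Ideal.span (Set.range u)) := by
  have h : (fun i => if i ∈ Finset.univ then u i ^ q else u i) = fun i => u i ^ q := by
    ext; simp
  have := length_quotient_span_pow_le u q Finset.univ
  rwa [h, Finset.card_univ] at this

theorem LechIndependent.pow_mul_length_le_univ {u : ι → R} {q : ℕ}
    (hu : LechIndependent fun i => u i ^ q) (hq : q ≠ 0) :
    q ^ Fintype.card ι * Module.length R (R ⧸ Ideal.span (Set.range u)) ≤
      Module.length R (R ⧸ Ideal.span (Set.range fun i => u i ^ q)) := by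
  have h : (fun i => if i ∈ Finset.univ then u i ^ q else u i) = fun i => u i ^ q := by
    ext; simp
  rw [← h] at hu ⊢
  rw [← Finset.card_univ]
  exact hu.pow_mul_length_le hq

end Lech

section Flat

open IsLocalRing

theorem RingHom.Flat.exists_factorization {R S ι : Type*} [CommRing R] [CommRing S] [Fintype ι]
    {f : R →+* S} (hf : f.Flat) {x : ι → R} {c : ι → S} (h : ∑ i, c i * f (x i) = 0) :
    ∃ (k : ℕ) (a : ι → Fin k → R) (y : Fin k → S),
      (∀ i, c i = ∑ j, f (a i j) * y j) ∧ ∀ j, ∑ i, x i * a i j = 0 := by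
  let := f.toAlgebra
  have : Module.Flat R S := hf
  have h' : Module.IsTrivialRelation x c := by
    refine Module.Flat.isTrivialRelation_of_sum_smul_eq_zero ?_
    rw [← h]
    exact Finset.sum_congr rfl fun i _ => (Algebra.smul_def _ _).trans (mul_comm _ _)
  obtain ⟨k, a, y, h1, h2⟩ := h'
  refine ⟨k, a, y, fun i => ?_, h2⟩
  rw [h1]
  exact Finset.sum_congr rfl fun i _ => Algebra.smul_def _ _

/-- If `c` is a nonzerodivisor modulo `I`, then its image under a flat map is a nonzerodivisor
modulo the extension of `I`. -/
theorem RingHom.Flat.mem_map_of_mul_mem_map {R S : Type*} [CommRing R] [CommRing S]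
    {f : R →+* S} (hf : f.Flat) {I : Ideal R} {c : R} (hc : ∀ r, c * r ∈ I → r ∈ I) {x : S}
    (hx : f c * x ∈ I.map f) : x ∈ I.map f := by
  obtain ⟨t, g, v, hv⟩ := Submodule.mem_span_set'.1 hx
  choose w hw hwv using fun i => (v i).2
  obtain ⟨k, a, y, h1, h2⟩ := hf.exists_factorization (ι := Option (Fin t))
    (x := fun o => o.elim c fun i => -w i) (c := fun o => o.elim x g) (by
      simp only [Fintype.sum_option, Option.elim_none, Option.elim_some, map_neg, mul_neg,
        Finset.sum_neg_distrib]
      rw [mul_comm x, ← hv, ← sub_eq_add_neg, sub_eq_zero]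
      exact Finset.sum_congr rfl fun i _ => by rw [hwv, smul_eq_mul])
  have h3 : x = ∑ j, f (a none j) * y j := h1 none
  rw [h3]
  refine Ideal.sum_mem _ fun j _ => Ideal.mul_mem_right _ _ (Ideal.mem_map_of_mem f (hc _ ?_))
  have h4 := h2 j
  simp only [Fintype.sum_option, Option.elim_none, Option.elim_some, neg_mul,
    Finset.sum_neg_distrib] at h4
  rw [← sub_eq_add_neg, sub_eq_zero] at h4
  rw [h4]
  exact Ideal.sum_mem _ fun i _ => Ideal.mul_mem_right _ _ (hw i)

theorem Ideal.sup_pow_add_add_one_le {R : Type*} [CommSemiring R] (I J : Ideal R) (n m : ℕ) :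
    (I ⊔ J) ^ (n + m + 1) ≤ I ^ (n + 1) ⊔ J ^ (m + 1) := by
  rw [← Ideal.add_eq_sup, add_pow, Ideal.sum_eq_sup]
  refine Finset.sup_le fun k _ => ?_
  by_cases hk : n + 1 ≤ k
  · exact Ideal.mul_le_left.trans (Ideal.mul_le_left.trans
      ((Ideal.pow_le_pow_right hk).trans le_sup_left))
  · exact Ideal.mul_le_left.trans (Ideal.mul_le_right.trans
      ((Ideal.pow_le_pow_right (by lia)).trans le_sup_right))

theorem Ideal.span_finset_pow_le {R : Type*} [CommSemiring R] (s : Finset R) (q : ℕ) :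
    Ideal.span (s : Set R) ^ (s.card * q + 1) ≤ Ideal.span ((· ^ (q + 1)) '' (s : Set R)) := by
  classical
  induction s using Finset.induction_on with
  | empty => simp
  | insert a s ha ih =>
    rw [Finset.card_insert_of_notMem ha, Finset.coe_insert, Set.image_insert_eq, Ideal.span_insert,
      Ideal.span_insert, add_one_mul, add_comm _ q]
    refine (Ideal.sup_pow_add_add_one_le _ _ _ _).trans (sup_le_sup ?_ ih)
    rw [Ideal.span_singleton_pow]

variable {R : Type*} [CommRing R] [IsLocalRing R]

/-- Coefficients of relations between minimal generators lie in the maximal ideal. -/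
theorem mem_maximalIdeal_of_sum_eq_zero {s : Finset R}
    (hs : Ideal.span (s : Set R) = maximalIdeal R)
    (hcard : s.card = (maximalIdeal R).spanFinrank) {a : s → R}
    (ha : ∑ i : s, a i * (i : R) = 0) (i : s) : a i ∈ maximalIdeal R := by
  classical
  by_contra hi
  obtain ⟨v, hv⟩ : IsUnit (a i) := by simpa using hi
  have hmem : (i : R) ∈ Ideal.span ((s.erase i : Finset R) : Set R) := by
    rw [← Finset.add_sum_erase _ _ (Finset.mem_univ i)] at ha
    have h1 : (i : R) = -(∑ j ∈ (Finset.univ : Finset s).erase i, a j * (j : R)) * (v⁻¹ : Rˣ) := by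
      rw [← eq_neg_of_add_eq_zero_left ha, ← hv, mul_right_comm, Units.mul_inv, one_mul]
    refine (congrArg (· ∈ Ideal.span ((s.erase i : Finset R) : Set R)) h1).mpr ?_
    refine Ideal.mul_mem_right _ _ (neg_mem (Ideal.sum_mem _ fun j hj => ?_))
    refine Ideal.mul_mem_left _ _ (Ideal.subset_span ?_)
    exact Finset.mem_coe.2 (Finset.mem_erase.2
      ⟨fun hji => Finset.ne_of_mem_erase hj (Subtype.ext hji), j.2⟩)
  have h2 : Ideal.span ((s.erase i : Finset R) : Set R) = maximalIdeal R := by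
    rw [← hs]
    refine le_antisymm (Ideal.span_mono (by simp)) (Ideal.span_le.2 fun j hj => ?_)
    by_cases hji : j = i
    · rw [hji]; exact hmem
    · exact Ideal.subset_span (by simpa [hji] using hj)
  have h3 := Submodule.spanFinrank_span_le_ncard_of_finite (R := R)
    (s.erase (i : R)).finite_toSet
  rw [Set.ncard_coe_finset] at h3
  have h4 := Finset.card_erase_lt_of_mem i.2
  have h5 : (Submodule.span R ((s.erase (i : R) : Finset R) : Set R)).spanFinrank =
    (maximalIdeal R).spanFinrank := congrArg _ h2
  omega

theorem lechIndependent_of_flat {s : Finset R} (hs : Ideal.span (s : Set R) = maximalIdeal R)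
    (hcard : s.card = (maximalIdeal R).spanFinrank) {f : R →+* R} (hf : f.Flat) :
    LechIndependent fun i : s => f i := by
  intro c hc i
  obtain ⟨k, a, y, h1, h2⟩ := hf.exists_factorization hc
  have h3 : (maximalIdeal R).map f = Ideal.span (Set.range fun i : s => f i) := by
    rw [← hs, Ideal.map_span]
    rw [Set.image_eq_range]
    rfl
  rw [← h3, h1 i]
  exact Ideal.sum_mem _ fun j _ => Ideal.mul_mem_right _ _
    (Ideal.mem_map_of_mem _ (mem_maximalIdeal_of_sum_eq_zero hs hcard
      (by simpa only [mul_comm] using h2 j) i))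

/-- Half of Kunz's theorem: a Noetherian local ring with flat Frobenius is regular. -/
theorem spanFinrank_maximalIdeal_le_of_flat [IsNoetherianRing R] (p : ℕ) [hp : Fact p.Prime] [ExpChar R p]
    (hflat : ∀ e, (iterateFrobenius R p e).Flat) {h : ℕ} (hh : (maximalIdeal R).height = h) :
    (maximalIdeal R).spanFinrank ≤ h := by
  classical
  obtain ⟨s, hcard, hs⟩ :=
    (IsNoetherian.noetherian (maximalIdeal R)).exists_span_finset_card_eq_spanFinrank
  obtain ⟨t, ht, htcard⟩ :=
    (maximalIdeal R).exists_finset_card_eq_height_of_isNoetherianRing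
  rw [hh, Nat.cast_inj] at htcard
  have hart := IsLocalRing.quotient_artinian_of_mem_minimalPrimes_of_isLocalRing _ ht
  have hart' : IsArtinian R (R ⧸ Ideal.span (t : Set R)) :=
    isArtinian_of_surjective_algebraMap (Ideal.Quotient.mk_surjective (I := .span (t : Set R)))
  obtain ⟨C, hC⟩ := ENat.ne_top_iff_exists.1
    (Module.length_ne_top (R := R) (M := R ⧸ Ideal.span (t : Set R)))
  have hrange : ∀ w : Finset R, Set.range (fun i : w => (i : R)) = w := fun w => by simp
  have key : ∀ e, (p ^ e) ^ s.card ≤ (p ^ e) ^ h * C := by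
    intro e
    set q := p ^ e with hq
    have hq0 : q ≠ 0 := pow_ne_zero _ hp.out.ne_zero
    have h1 : LechIndependent fun i : s => (i : R) ^ q :=
      lechIndependent_of_flat hs hcard (hflat e)
    have h2 := h1.pow_mul_length_le_univ hq0
    have h3 := length_quotient_span_pow_le_univ (fun i : t => (i : R)) q
    simp only [Fintype.card_coe] at h2 h3
    rw [hrange, ← hC, htcard] at h3
    rw [hrange] at h2
    have h4 : Ideal.span (Set.range fun i : t => (i : R) ^ q) ≤
        Ideal.span (Set.range fun i : s => (i : R) ^ q) := by
      have h5 : (maximalIdeal R).map (iterateFrobenius R p e) =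
          Ideal.span (Set.range fun i : s => (i : R) ^ q) := by
        rw [← hs, ← Ideal.span, Ideal.map_span]
        congr 1
        ext; simp [iterateFrobenius_def, hq]
      rw [← h5, Ideal.span_le]
      rintro _ ⟨i, rfl⟩
      exact Ideal.mem_map_of_mem (iterateFrobenius R p e) (ht.1.2 (Ideal.subset_span i.2))
    have h6 := Module.length_le_of_surjective (Submodule.factor h4)
      (Submodule.factor_surjective _)
    have h7 : (1 : ℕ∞) ≤ Module.length R (R ⧸ Ideal.span (s : Set R)) := by
      have : Nontrivial (R ⧸ Ideal.span (s : Set R)) :=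
        Ideal.Quotient.nontrivial_iff.2 (by rw [Ideal.span, hs]; exact Ideal.IsPrime.ne_top')
      exact Order.one_le_iff_pos.2 Module.length_pos
    have h8 : (q : ℕ∞) ^ s.card ≤ q ^ h * C := by
      calc (q : ℕ∞) ^ s.card = q ^ s.card * 1 := (mul_one _).symm
        _ ≤ _ := by gcongr
        _ ≤ _ := h2
        _ ≤ _ := h6
        _ ≤ _ := h3
    exact_mod_cast h8
  by_contra! hlt
  rw [← hcard] at hlt
  have h1 := key C
  have h2 : (p ^ C) ^ (h + 1) ≤ (p ^ C) ^ h * C :=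
    (Nat.pow_le_pow_right (pow_pos hp.out.pos _) hlt).trans h1
  rw [pow_succ] at h2
  have h3 := Nat.le_of_mul_le_mul_left h2 (pow_pos (pow_pos hp.out.pos _) _)
  exact absurd h3 (not_le.2 (Nat.lt_pow_self hp.out.one_lt))

end Flat

section Regular

open IsLocalRing RingTheory.Sequence Pointwise

theorem RingTheory.Sequence.IsWeaklyRegular.map_pow {R : Type*} [CommRing R] [IsLocalRing R]
    {M : Type*} [AddCommGroup M] [Module R M] [IsNoetherian R M] {rs : List R} {n : ℕ}
    (hn : n ≠ 0) (h : IsWeaklyRegular M rs) (hm : ∀ r ∈ rs, r ∈ maximalIdeal R) :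
    IsWeaklyRegular M (rs.map (· ^ n)) := by
  induction rs generalizing M with
  | nil => exact .nil R M
  | cons r rs ih =>
    rw [List.forall_mem_cons] at hm
    rw [isWeaklyRegular_cons_iff] at h
    have hpow : ∀ x ∈ rs.map (· ^ n), x ∈ maximalIdeal R := by
      simpa using fun a ha => Ideal.pow_mem_of_mem _ (hm.2 a ha) n (Nat.pos_of_ne_zero hn)
    have h1 : IsWeaklyRegular M (r :: rs.map (· ^ n)) := .cons h.1 (ih h.2 hm.2)
    have h2 := isWeaklyRegular_of_perm_of_subset_maximalIdeal h1
      (List.perm_append_singleton r (rs.map (· ^ n))).symm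
      (List.forall_mem_cons.2 ⟨hm.1, hpow⟩)
    rw [isWeaklyRegular_append_iff, isWeaklyRegular_singleton_iff] at h2
    have h3 : IsWeaklyRegular M (rs.map (· ^ n) ++ [r ^ n]) := by
      rw [isWeaklyRegular_append_iff, isWeaklyRegular_singleton_iff]
      exact ⟨h2.1, h2.2.pow n⟩
    refine isWeaklyRegular_of_perm_of_subset_maximalIdeal h3
      (List.perm_append_singleton (r ^ n) (rs.map (· ^ n))) ?_
    rw [List.forall_mem_append, List.forall_mem_singleton]
    exact ⟨hpow, Ideal.pow_mem_of_mem _ hm.1 n (Nat.pos_of_ne_zero hn)⟩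

/-- A finite module over a Noetherian local ring on which generators of the maximal ideal form a
weakly regular sequence is free. -/
theorem Module.Free.of_isWeaklyRegular_of_ofList_eq_maximalIdeal {R : Type*} [CommRing R]
    [IsLocalRing R] [IsNoetherianRing R] {M : Type*} [AddCommGroup M] [Module R M]
    [Module.Finite R M] {rs : List R} (h : IsWeaklyRegular M rs)
    (hrs : Ideal.ofList rs = maximalIdeal R) : Module.Free R M := by
  induction hl : rs.length generalizing R M rs with
  | zero =>
    obtain rfl := List.length_eq_zero_iff.1 hl
    rw [Ideal.ofList_nil] at hrs
    let := ((isField_iff_maximalIdeal_eq (R := R)).2 hrs.symm).toField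
    exact Module.Free.of_divisionRing R M
  | succ n ih =>
    obtain ⟨r, rs, rfl⟩ := List.exists_cons_of_length_eq_add_one hl
    rw [isWeaklyRegular_cons_iff'] at h
    have hr : r ∈ maximalIdeal R := by
      rw [← hrs]; exact Ideal.subset_span (by simp)
    have : Nontrivial (R ⧸ Ideal.span {r}) := Ideal.Quotient.nontrivial_iff.2
      (ne_top_of_le_ne_top Ideal.IsPrime.ne_top' ((Ideal.span_singleton_le_iff_mem _).2 hr))
    have hloc := IsLocalRing.of_surjective' (Ideal.Quotient.mk (Ideal.span {r}))
      Ideal.Quotient.mk_surjective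
    have : Module.Finite (R ⧸ Ideal.span {r}) (QuotSMulTop r M) :=
      Module.Finite.of_restrictScalars_finite R _ _
    have : Module.FinitePresentation R M := Module.finitePresentation_of_finite R M
    rw [← Module.free_quotSMulTop_iff_free R M (x := r)
      (by rw [IsLocalRing.jacobson_eq_maximalIdeal _ bot_ne_top]; exact hr) h.1]
    refine ih h.2 ?_ (by simpa using hl)
    rw [← Ideal.map_ofList, ← IsLocalRing.map_maximalIdeal_of_surjective
      (Ideal.Quotient.mk (Ideal.span {r})) Ideal.Quotient.mk_surjective, ← hrs, Ideal.ofList_cons,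
      Ideal.map_sup, Ideal.map_quotient_self, bot_sup_eq]

theorem IsLocalRing.exists_span_insert_eq_maximalIdeal {R : Type*} [CommRing R] [IsLocalRing R]
    [IsNoetherianRing R] {x : R} (hx : x ∈ maximalIdeal R) (hx2 : x ∉ maximalIdeal R ^ 2) :
    ∃ s : Finset R, s.card + 1 = (maximalIdeal R).spanFinrank ∧
      Ideal.span (insert x (s : Set R)) = maximalIdeal R := by
  classical
  obtain ⟨t, hcard, ht⟩ :=
    (IsNoetherian.noetherian (maximalIdeal R)).exists_span_finset_card_eq_spanFinrank
  obtain ⟨f, hf⟩ := Submodule.mem_span_finset'.1 (ht ▸ hx)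
  obtain ⟨i, hi⟩ : ∃ i, f i ∉ maximalIdeal R := by
    by_contra! hall
    refine hx2 (hf ▸ Ideal.sum_mem _ fun i _ => ?_)
    rw [pow_two]
    exact Ideal.mul_mem_mul (hall i) (ht ▸ Submodule.subset_span i.2)
  obtain ⟨v, hv⟩ : IsUnit (f i) := by simpa using hi
  refine ⟨t.erase i, by rw [Finset.card_erase_add_one i.2, hcard], le_antisymm ?_ ?_⟩
  · rw [Ideal.span_le, Set.insert_subset_iff]
    refine ⟨hx, fun j hj => ?_⟩
    exact ht ▸ Submodule.subset_span (Finset.mem_of_mem_erase (Finset.mem_coe.1 hj))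
  · have hmem : (i : R) ∈ Ideal.span (insert x ((t.erase i : Finset R) : Set R)) := by
      have hsum : f i * (i : R) = x - ∑ j ∈ (Finset.univ : Finset t).erase i, f j * (j : R) := by
        rw [eq_sub_iff_add_eq, ← hf]
        exact Finset.add_sum_erase Finset.univ (fun j : t => f j * (j : R)) (Finset.mem_univ i)
      refine (Ideal.unit_mul_mem_iff_mem _ (hv ▸ v.isUnit : IsUnit (f i))).1 ?_
      refine (congrArg (· ∈ Ideal.span (insert x ((t.erase i : Finset R) : Set R))) hsum).mpr ?_
      refine Ideal.sub_mem _ (Ideal.subset_span (Set.mem_insert _ _))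
        (Ideal.sum_mem _ fun j hj => Ideal.mul_mem_left _ _ (Ideal.subset_span ?_))
      exact Set.mem_insert_of_mem _ (Finset.mem_coe.2 (Finset.mem_erase.2
        ⟨fun hji => Finset.ne_of_mem_erase hj (Subtype.ext hji), j.2⟩))
    rw [← ht]
    refine Ideal.span_le.2 fun j hj => ?_
    by_cases hji : j = i
    · rw [hji]; exact hmem
    · exact Ideal.subset_span (Set.mem_insert_of_mem _
        (Finset.mem_coe.2 (Finset.mem_erase.2 ⟨hji, hj⟩)))

theorem IsRegularLocalRing.exists_isWeaklyRegular_aux (d : ℕ) (R : Type*) [CommRing R]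
    [IsRegularLocalRing R] (hd : ringKrullDim R = d) :
    IsDomain R ∧ ∃ rs : List R, IsWeaklyRegular R rs ∧ Ideal.ofList rs = maximalIdeal R := by
  classical
  induction d generalizing R with
  | zero =>
    have h := IsRegularLocalRing.spanFinrank_maximalIdeal (R := R)
    rw [hd, Nat.cast_inj, Submodule.spanFinrank_eq_zero_iff_eq_bot
      (IsNoetherian.noetherian _)] at h
    have hfield := (isField_iff_maximalIdeal_eq (R := R)).2 h
    exact ⟨hfield.isDomain, [], .nil R R, by rw [Ideal.ofList_nil, h]⟩
  | succ d ih =>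
    have hrank := IsRegularLocalRing.spanFinrank_maximalIdeal (R := R)
    rw [hd, Nat.cast_inj] at hrank
    obtain ⟨x, hxm, hx2, hxmin⟩ : ∃ x ∈ maximalIdeal R, x ∉ maximalIdeal R ^ 2 ∧
        ∀ P ∈ minimalPrimes R, x ∉ P := by
      by_contra! hcon
      have hsub : (maximalIdeal R : Set R) ⊆
          ⋃ J ∈ insert (maximalIdeal R ^ 2) (minimalPrimes R), (id J : Ideal R) := by
        intro x hx
        by_cases hx2 : x ∈ maximalIdeal R ^ 2
        · exact Set.mem_biUnion (Set.mem_insert _ _) hx2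
        · obtain ⟨P, hP, hxP⟩ := hcon x hx hx2
          exact Set.mem_biUnion (Set.mem_insert_of_mem _ hP) hxP
      obtain ⟨J, hJ, hle⟩ := (Ideal.subset_union_prime_finite
        ((minimalPrimes.finite_of_isNoetherianRing R).insert _)
        (maximalIdeal R ^ 2) (maximalIdeal R ^ 2)
        (fun J hJ hJne _ => (Set.mem_of_mem_insert_of_ne hJ hJne).1.1)).1 hsub
      rcases hJ with rfl | hJ
      · have h : maximalIdeal R = ⊥ := Submodule.eq_bot_of_le_smul_of_le_jacobson_bot
          (maximalIdeal R) _ (IsNoetherian.noetherian _) (hle.trans_eq (pow_two _))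
          (IsLocalRing.maximalIdeal_le_jacobson _)
        rw [h, Submodule.spanFinrank_bot] at hrank
        omega
      · have h : maximalIdeal R ∈ minimalPrimes R := by
          rwa [le_antisymm hle (IsLocalRing.le_maximalIdeal hJ.1.1.ne_top)]
        rw [← Ideal.height_eq_zero_iff] at h
        rw [← IsLocalRing.maximalIdeal_height_eq_ringKrullDim, h] at hd
        exact absurd hd.symm (by exact_mod_cast d.succ_ne_zero)
    have hle : Ideal.span {x} ≤ maximalIdeal R := (Ideal.span_singleton_le_iff_mem _).2 hxm
    have : Nontrivial (R ⧸ Ideal.span {x}) := Ideal.Quotient.nontrivial_iff.2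
      (ne_top_of_le_ne_top Ideal.IsPrime.ne_top' hle)
    have hloc := IsLocalRing.of_surjective' (Ideal.Quotient.mk (Ideal.span {x}))
      Ideal.Quotient.mk_surjective
    have hmap : (maximalIdeal R).map (Ideal.Quotient.mk (Ideal.span {x})) =
        maximalIdeal (R ⧸ Ideal.span {x}) :=
      IsLocalRing.map_maximalIdeal_of_surjective _ Ideal.Quotient.mk_surjective
    have hfin : (maximalIdeal (R ⧸ Ideal.span {x})).spanFinrank ≤ d := by
      obtain ⟨s, hs, hspan⟩ := exists_span_insert_eq_maximalIdeal hxm hx2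
      have h : maximalIdeal (R ⧸ Ideal.span {x}) =
          Ideal.span (s.image (Ideal.Quotient.mk (Ideal.span {x})) : Set (R ⧸ Ideal.span {x})) := by
        rw [← hmap, ← hspan, Ideal.span_insert, Ideal.map_sup, Ideal.map_quotient_self,
          bot_sup_eq, Ideal.map_span, Finset.coe_image]
      rw [h]
      refine (Submodule.spanFinrank_span_le_ncard_of_finite (Finset.finite_toSet _)).trans ?_
      rw [Set.ncard_coe_finset]
      exact Finset.card_image_le.trans (by omega)
    have hdim : ringKrullDim R ≤ ringKrullDim (R ⧸ Ideal.span {x}) + 1 := by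
      have h := ringKrullDim_le_ringKrullDim_quotient_add_card (R := R) (s := {x})
        (by simpa [IsLocalRing.ringJacobson_eq_maximalIdeal] using hxm)
      rwa [Finset.coe_singleton, Finset.card_singleton, Nat.cast_one] at h
    have hdim' : (d : WithBot ℕ∞) ≤ ringKrullDim (R ⧸ Ideal.span {x}) := by
      rw [hd] at hdim
      push_cast at hdim
      exact ENat.WithBot.add_le_add_one_right_iff.1 hdim
    have hreg : IsRegularLocalRing (R ⧸ Ideal.span {x}) :=
      .of_spanFinrank_maximalIdeal_le _ ((Nat.cast_le.2 hfin).trans hdim')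
    have hd' : ringKrullDim (R ⧸ Ideal.span {x}) = d :=
      le_antisymm ((ringKrullDim_le_spanFinrank_maximalIdeal _).trans (Nat.cast_le.2 hfin)) hdim'
    obtain ⟨hdom, rs', hrs', hofList⟩ := ih (R ⧸ Ideal.span {x}) hd'
    have hprime : (Ideal.span {x}).IsPrime := (Ideal.Quotient.isDomain_iff_prime _).1 hdom
    have hR : IsDomain R := by
      obtain ⟨P, hP, hPx⟩ := Ideal.exists_minimalPrimes_le (bot_le (a := Ideal.span {x}))
      have hPprime : P.IsPrime := hP.1.1
      have h1 : P ≤ Ideal.span {x} * P := by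
        intro y hy
        obtain ⟨z, rfl⟩ := Ideal.mem_span_singleton'.1 (hPx hy)
        rw [mul_comm z]
        exact Ideal.mul_mem_mul (Ideal.mem_span_singleton_self x)
          ((hPprime.mem_or_mem hy).resolve_right (hxmin P hP))
      have h2 : P = ⊥ := Submodule.eq_bot_of_le_smul_of_le_jacobson_bot (Ideal.span {x}) P
        (IsNoetherian.noetherian P) h1
        (by rwa [IsLocalRing.jacobson_eq_maximalIdeal _ bot_ne_top])
      rw [h2] at hPprime
      exact IsDomain.of_bot_isPrime R
    refine ⟨hR, ?_⟩
    obtain ⟨rs, rfl⟩ := (List.map_surjective_iff.2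
      (Ideal.Quotient.mk_surjective (I := Ideal.span {x}))) rs'
    refine ⟨x :: rs, ?_, ?_⟩
    · rw [isWeaklyRegular_cons_iff]
      constructor
      · have hx0 : x ≠ 0 := fun h => hx2 (by rw [h]; exact zero_mem _)
        exact IsLeftRegular.isSMulRegular (IsRegular.of_ne_zero hx0).left
      · have e : (R ⧸ Ideal.span {x}) ≃ₗ[R] QuotSMulTop x R :=
          Submodule.quotEquivOfEq _ _ (by
            rw [← Submodule.ideal_span_singleton_smul x ⊤, smul_eq_mul, Ideal.mul_top])
        rw [← e.isWeaklyRegular_congr]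
        exact (isWeaklyRegular_map_algebraMap_iff (R ⧸ Ideal.span {x}) _ rs).1 hrs'
    · rw [← Ideal.map_ofList, ← hmap] at hofList
      have h := congrArg (Ideal.comap (Ideal.Quotient.mk (Ideal.span {x}))) hofList
      rw [Ideal.comap_map_of_surjective _ Ideal.Quotient.mk_surjective,
        Ideal.comap_map_of_surjective _ Ideal.Quotient.mk_surjective, ← RingHom.ker_eq_comap_bot,
        Ideal.mk_ker, sup_eq_left.2 hle, sup_comm] at h
      rw [Ideal.ofList_cons, h]

theorem IsRegularLocalRing.exists_isWeaklyRegular (R : Type*) [CommRing R]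
    [IsRegularLocalRing R] :
    ∃ rs : List R, IsWeaklyRegular R rs ∧ Ideal.ofList rs = maximalIdeal R :=
  (exists_isWeaklyRegular_aux _ R IsRegularLocalRing.spanFinrank_maximalIdeal.symm).2

theorem RingHom.Flat.of_isWeaklyRegular_map {R S : Type*} [CommRing R] [IsLocalRing R]
    [IsNoetherianRing R] [CommRing S] {f : R →+* S} (hf : f.Finite) {rs : List R}
    (hrs : Ideal.ofList rs = maximalIdeal R) (h : IsWeaklyRegular S (rs.map f)) : f.Flat := by
  let := f.toAlgebra
  have : Module.Finite R S := hf
  have h' : IsWeaklyRegular S rs := (isWeaklyRegular_map_algebraMap_iff S S rs).1 h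
  have := Module.Free.of_isWeaklyRegular_of_ofList_eq_maximalIdeal h' hrs
  exact (inferInstance : Module.Flat R S)

/-- Half of Kunz's theorem, in the F-finite case: the Frobenius of a regular local ring is
flat. -/
theorem IsRegularLocalRing.flat_frobenius {R : Type*} [CommRing R] [IsRegularLocalRing R] {p : ℕ}
    [ExpChar R p] (hfin : (frobenius R p).Finite) : (frobenius R p).Flat := by
  obtain ⟨rs, h, hrs⟩ := exists_isWeaklyRegular R
  refine .of_isWeaklyRegular_map hfin hrs ?_
  have hm : ∀ r ∈ rs, r ∈ maximalIdeal R := fun r hr => hrs ▸ Ideal.subset_span hr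
  exact h.map_pow (expChar_pos R p).ne' hm

theorem RingHom.Flat.iterateFrobenius {R : Type*} [CommRing R] {p : ℕ} [ExpChar R p]
    (h : (frobenius R p).Flat) (e : ℕ) : (iterateFrobenius R p e).Flat := by
  induction e with
  | zero =>
    rw [iterateFrobenius_zero]
    exact RingHom.Flat.id R
  | succ e ih =>
    have : _root_.iterateFrobenius R p (e + 1) =
        (_root_.frobenius R p).comp (_root_.iterateFrobenius R p e) := by
      ext x
      simp [iterateFrobenius_def, frobenius_def, pow_succ, pow_mul]
    rw [this]
    exact ih.comp h

end Regular

theorem FFinite.finite_frobenius {R : Type*} [CommRing R] {p : ℕ} [ExpChar R p]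
    (h : FFinite R p) : (frobenius R p).Finite := by
  have hrange : (frobenius R p).range = pthPowers R p := by
    rw [pthPowers, ← Subring.closure_eq (frobenius R p).range, RingHom.coe_range]
    rfl
  have hfin : (frobenius R p).range.subtype.Finite := by
    rw [hrange]
    have : Module.Finite (pthPowers R p) R := h
    exact RingHom.finite_algebraMap.2 this
  exact hfin.comp (RingHom.Finite.of_surjective _ (frobenius R p).rangeRestrict_surjective)

theorem IsRegularLocal.isRegularLocalRing {R : Type*} [CommRing R] [IsLocalRing R]
    (h : IsRegularLocal R) : IsRegularLocalRing R := by
  obtain ⟨hN, s, hs, hcard⟩ := h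
  refine .of_spanFinrank_maximalIdeal_le _ ?_
  rw [← hcard, ← hs]
  have := Submodule.spanFinrank_span_le_ncard_of_finite (R := R) s.finite_toSet
  rw [Set.ncard_coe_finset] at this
  exact_mod_cast this

theorem frobeniusPower_eq_map {R : Type*} [CommRing R] {p : ℕ} [ExpChar R p] (I : Ideal R)
    (e : ℕ) : frobeniusPower I (p ^ e) = I.map (iterateFrobenius R p e) :=
  rfl

section FrobeniusPower

open IsLocalRing

/-- If the iterated Frobenius maps of a Noetherian local ring of dimension `h` are flat, then
`𝔪 ^ (h * (q - 1) + 1) ≤ 𝔪^[q]`. -/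
theorem IsLocalRing.maximalIdeal_pow_le_map_iterateFrobenius {R : Type*} [CommRing R]
    [IsLocalRing R] [IsNoetherianRing R] (p : ℕ) [hp : Fact p.Prime] [ExpChar R p]
    (hflat : ∀ e, (iterateFrobenius R p e).Flat) {h : ℕ} (hh : (maximalIdeal R).height = h)
    (e : ℕ) : maximalIdeal R ^ (h * (p ^ e - 1) + 1) ≤
      (maximalIdeal R).map (iterateFrobenius R p e) := by
  obtain ⟨s, hcard, hs⟩ := (IsNoetherian.noetherian
    (maximalIdeal R)).exists_span_finset_card_eq_spanFinrank
  have hle : s.card ≤ h := hcard.trans_le (spanFinrank_maximalIdeal_le_of_flat p hflat hh)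
  have hspan : Ideal.span (s : Set R) = maximalIdeal R := hs
  have hq : p ^ e - 1 + 1 = p ^ e := Nat.sub_add_cancel (Nat.pow_pos hp.out.pos)
  calc maximalIdeal R ^ (h * (p ^ e - 1) + 1)
      ≤ maximalIdeal R ^ (s.card * (p ^ e - 1) + 1) := Ideal.pow_le_pow_right (by gcongr)
    _ ≤ Ideal.span ((· ^ (p ^ e - 1 + 1)) '' (s : Set R)) := by
      rw [← hspan]
      exact Ideal.span_finset_pow_le s _
    _ ≤ (maximalIdeal R).map (iterateFrobenius R p e) := by
      rw [hq, ← hspan, Ideal.map_span]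
      exact le_of_eq rfl

/-- An ideal containing, for each minimal prime `P` of a radical ideal `I`, an element outside
`P`, contains a nonzerodivisor modulo `I`. -/
theorem Ideal.IsRadical.exists_mem_forall_mul_mem {R : Type*} [CommRing R] [IsNoetherianRing R]
    {I J : Ideal R} (hI : I.IsRadical) (hJ : ∀ P ∈ I.minimalPrimes, ¬ J ≤ P) :
    ∃ c ∈ J, ∀ r, c * r ∈ I → r ∈ I := by
  have hsub : ¬ (J : Set R) ⊆ ⋃ P ∈ I.minimalPrimes, (id P : Ideal R) := by
    intro hsub
    obtain ⟨P, hP, hle⟩ := (Ideal.subset_union_prime_finite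
      (Ideal.finite_minimalPrimes_of_isNoetherianRing R I) ⊤ ⊤ (fun P hP _ _ => hP.1.1)).1 hsub
    exact hJ P hP hle
  obtain ⟨c, hcJ, hc⟩ := Set.not_subset.1 hsub
  simp only [id, Set.mem_iUnion, SetLike.mem_coe, not_exists] at hc
  refine ⟨c, hcJ, fun r hr => ?_⟩
  rw [← hI.radical, ← Ideal.sInf_minimalPrimes, Ideal.mem_sInf] at hr ⊢
  exact fun P hP => (hP.1.1.mem_or_mem (hr hP)).resolve_left (hc P hP)

theorem iterateFrobenius_flat_localization {R : Type*} [CommRing R] (p e : ℕ) [ExpChar R p]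
    (hflat : (iterateFrobenius R p e).Flat) (P : Ideal R) [hP : P.IsPrime]
    [hp : Fact p.Prime] [ExpChar (Localization.AtPrime P) p] :
    (iterateFrobenius (Localization.AtPrime P) p e).Flat := by
  have hcomap : P = P.comap (iterateFrobenius R p e) := by
    ext x
    rw [Ideal.mem_comap, iterateFrobenius_def]
    exact (hP.pow_mem_iff_mem _ (Nat.pow_pos hp.out.pos)).symm
  rw [← Localization.localRingHom_unique P P (iterateFrobenius R p e) hcomap
    (j := iterateFrobenius (Localization.AtPrime P) p e)
    fun x => ((algebraMap R (Localization.AtPrime P)).map_iterateFrobenius p x e).symm]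
  exact hflat.localRingHom P P hcomap

/-- If the iterated Frobenius maps are flat, then `I ^ (h * (q - 1) + 1)` lies in `I^[q]` locally
at each minimal prime of height `h` of the radical ideal `I`. -/
theorem Ideal.exists_notMem_mul_mem_map_iterateFrobenius {R : Type*} [CommRing R]
    [IsNoetherianRing R] (p : ℕ) [hp : Fact p.Prime] [CharP R p]
    (hflat : ∀ e, (iterateFrobenius R p e).Flat) {I P : Ideal R} (hI : I.IsRadical)
    (hP : P ∈ I.minimalPrimes) {h : ℕ} (hh : P.height = h) (e : ℕ) {x : R}
    (hx : x ∈ I ^ (h * (p ^ e - 1) + 1)) :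
    ∃ c ∉ P, c * x ∈ I.map (iterateFrobenius R p e) := by
  have hPp : P.IsPrime := hP.1.1
  let S := Localization.AtPrime P
  have : CharP S p := (CharP.charP_iff_prime_eq_zero hp.out).2 <| by
    rw [← map_natCast (algebraMap R S), CharP.cast_eq_zero, map_zero]
  have hflatS (e : ℕ) : (iterateFrobenius S p e).Flat :=
    iterateFrobenius_flat_localization p e (hflat e) P
  have hhS : (maximalIdeal S).height = h := by
    have h1 := IsLocalRing.maximalIdeal_height_eq_ringKrullDim (R := S)
    rw [IsLocalization.AtPrime.ringKrullDim_eq_height P S, hh] at h1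
    exact_mod_cast h1
  have hIS : I.map (algebraMap R S) = maximalIdeal S := by
    rw [← Localization.AtPrime.map_eq_maximalIdeal,
      ← IsLocalization.AtPrime.radical_map_of_mem_minimalPrimes S P I hP,
      ← IsLocalization.map_radical P.primeCompl, hI.radical]
  have hxS : algebraMap R S x ∈ (I.map (iterateFrobenius R p e)).map (algebraMap R S) := by
    have hcomm : (algebraMap R S).comp (iterateFrobenius R p e) =
        (iterateFrobenius S p e).comp (algebraMap R S) :=
      RingHom.ext fun x => (algebraMap R S).map_iterateFrobenius p x e
    rw [Ideal.map_map, hcomm, ← Ideal.map_map, hIS]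
    refine maximalIdeal_pow_le_map_iterateFrobenius p hflatS hhS e ?_
    rw [← hIS, ← Ideal.map_pow]
    exact Ideal.mem_map_of_mem _ hx
  exact (IsLocalization.algebraMap_mem_map_algebraMap_iff P.primeCompl S _ x).1 hxS

/-- If the iterated Frobenius maps are flat and every minimal prime of the radical ideal `I` has
height `h`, then `I ^ (h * (q - 1) + 1) ≤ I^[q]`. -/
theorem Ideal.IsRadical.pow_le_map_iterateFrobenius {R : Type*} [CommRing R]
    [IsNoetherianRing R] (p : ℕ) [hp : Fact p.Prime] [CharP R p]
    (hflat : ∀ e, (iterateFrobenius R p e).Flat) {I : Ideal R} (hI : I.IsRadical) {h : ℕ}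
    (hh : ∀ P ∈ I.minimalPrimes, P.height = h) (e : ℕ) :
    I ^ (h * (p ^ e - 1) + 1) ≤ I.map (iterateFrobenius R p e) := by
  intro x hx
  obtain ⟨c, hc, hcI⟩ := hI.exists_mem_forall_mul_mem
    (J := (I.map (iterateFrobenius R p e)).colon {x}) fun P hP hle => by
      obtain ⟨c, hcP, hc⟩ :=
        Ideal.exists_notMem_mul_mem_map_iterateFrobenius p hflat hI hP (hh P hP) e hx
      exact hcP (hle (Submodule.mem_colon_singleton.2 hc))
  refine (hflat e).mem_map_of_mul_mem_map hcI ?_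
  rw [iterateFrobenius_def, ← Nat.sub_add_cancel (Nat.pow_pos hp.out.pos : 1 ≤ p ^ e), pow_succ,
    mul_assoc]
  exact Ideal.mul_mem_left _ _ (Submodule.mem_colon_singleton.1 hc)

end FrobeniusPower

/-- for an unmixed reduced ideal `I` of height `h > 0` in an F-finite
regular local ring of characteristic `p`, one has `I^{h(q-1)} ⊆ (I^{[q]} : I)` for
every `q = p^e`. -/
theorem pow_le_colon_frobeniusPower {R : Type*} [CommRing R] [IsLocalRing R] (p : ℕ)
    [Fact p.Prime] [CharP R p] (hreg : IsRegularLocal R) (hFF : FFinite R p)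
    (I : Ideal R) (hIne : I ≠ ⊤) (h : ℕ) (hh : 0 < h)
    (hI : UnmixedReducedOfHeight I h) (e : ℕ) :
    I ^ (h * (p ^ e - 1)) ≤ Submodule.colon (frobeniusPower I (p ^ e)) I := by
  have := hreg.1
  have := hreg.isRegularLocalRing
  have hflat (e : ℕ) : (iterateFrobenius R p e).Flat :=
    (IsRegularLocalRing.flat_frobenius hFF.finite_frobenius).iterateFrobenius e
  have hheight (P : Ideal R) (hP : P ∈ I.minimalPrimes) : P.height = h :=
    (PrimeSpectrum.height_eq_orderHeight ⟨P, hP.1.1⟩).trans (hI.2 P hP.1.1 hP)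
  intro x hx
  rw [Submodule.mem_colon]
  intro y hy
  rw [frobeniusPower_eq_map]
  refine hI.1.pow_le_map_iterateFrobenius p hflat hheight e ?_
  rw [pow_succ]
  exact Ideal.mul_mem_mul hx hy
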